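/- arXiv:1307.5796 — 7 statements merged into one kernel-verified Lean document; each statement's English description precedes it below -/
import Mathlib

section
/- Let Φ be a continuous flow on a compact metric space M (a continuous map Φ : ℝ × M → M with Φ_0 = id and Φ_{t+s} = Φ_t ∘ Φ_s). Suppose Λ ⊆ M is neutral, i.e. Λ = Λ⁺ ∩ Λ⁻ where Λ⁺ is a compact invariant set that is Lyapunov stable for Φ and Λ⁻ is a compact invariant set that is Lyapunov stable for the time-reversed flow (t,x) ↦ Φ_{−t}(x). If a point x ∈ M satisfies ω(x) ∩ Λ ≠ ∅, then ω(x) ⊆ Λ. -/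
open Set Filter Topology

/-- The omega-limit set of `x` under the flow `Φ`: the set of limits of `Φ (t k) x`
along sequences `t k → ∞`. -/
def omegaSet {M : Type*} [TopologicalSpace M] (Φ : ℝ → M → M) (x : M) : Set M :=
  {y | ∃ t : ℕ → ℝ, Tendsto t atTop atTop ∧ Tendsto (fun k => Φ (t k) x) atTop (𝓝 y)}

/-- `Λ` is Lyapunov stable for the (semi)flow `Φ`: for every neighborhood `U` of `Λ`
there is a neighborhood `V ⊆ U` of `Λ` with `Φ t V ⊆ U` for all `t ≥ 0`. -/
def LyapunovStable {M : Type*} [TopologicalSpace M] (Φ : ℝ → M → M) (Λ : Set M) : Prop :=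
  ∀ U ∈ 𝓝ˢ Λ, ∃ V ∈ 𝓝ˢ Λ, V ⊆ U ∧ ∀ t : ℝ, 0 ≤ t → ∀ x ∈ V, Φ t x ∈ U

theorem stmt_0 {M : Type*} [MetricSpace M] [CompactSpace M]
    (Φ : ℝ → M → M)
    (hΦcont : Continuous fun p : ℝ × M => Φ p.1 p.2)
    (hΦ0 : ∀ x, Φ 0 x = x)
    (hΦadd : ∀ t s : ℝ, ∀ x, Φ (t + s) x = Φ t (Φ s x))
    (Λ Λp Λm : Set M)
    (hΛ : Λ = Λp ∩ Λm)
    (hpK : IsCompact Λp) (hpInv : ∀ t : ℝ, Φ t '' Λp = Λp)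
    (hpStab : LyapunovStable Φ Λp)
    (hmK : IsCompact Λm) (hmInv : ∀ t : ℝ, Φ t '' Λm = Λm)
    (hmStab : LyapunovStable (fun t => Φ (-t)) Λm)
    (x : M) (hx : (omegaSet Φ x ∩ Λ).Nonempty) :
    omegaSet Φ x ⊆ Λ := by
  obtain ⟨y, ⟨t, ht, hty⟩, hyΛ⟩ := hx
  subst hΛ
  have key : ∀ (L : Set M), IsCompact L → ∀ z, z ∉ L → ∃ U ∈ 𝓝ˢ L, IsClosed U ∧ z ∉ U := by
    intro L hL z hz
    have hd : Disjoint L {z} := Set.disjoint_singleton_right.2 hz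
    obtain ⟨A, B, hA, hB, hLA, hzB, hAB⟩ := SeparatedNhds.of_isCompact_isCompact hL isCompact_singleton hd
    refine ⟨Bᶜ, ?_, hB.isClosed_compl, fun h => h (hzB rfl)⟩
    exact mem_of_superset (hA.mem_nhdsSet.2 hLA) hAB.subset_compl_right
  rintro z ⟨s, hs, hsz⟩
  constructor
  · by_contra hz
    obtain ⟨U, hU, hUc, hzU⟩ := key Λp hpK z hz
    obtain ⟨V, hV, -, hVU⟩ := hpStab U hU
    have hVy : V ∈ 𝓝 y := nhds_le_nhdsSet hyΛ.1 hV
    obtain ⟨k, hk⟩ := (hty.eventually hVy).exists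
    refine hzU (hUc.mem_of_tendsto hsz ?_)
    filter_upwards [hs.eventually_ge_atTop (t k)] with n hn
    have h := hVU (s n - t k) (by linarith) _ hk
    rw [← hΦadd] at h
    simpa using h
  · by_contra hz
    obtain ⟨U, hU, hUc, hzU⟩ := key Λm hmK z hz
    obtain ⟨V, hV, -, hVU⟩ := hmStab U hU
    have hVy : V ∈ 𝓝 y := nhds_le_nhdsSet hyΛ.2 hV
    refine hzU (hUc.mem_of_tendsto hsz (Eventually.of_forall fun n => ?_))
    obtain ⟨k, hk, hk2⟩ := ((hty.eventually hVy).and (ht.eventually_ge_atTop (s n))).exists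
    have h := hVU (t k - s n) (by linarith) _ hk
    simp only [← hΦadd] at h
    simpa using h
end

section
/- Let Φ be a continuous flow on a compact metric space M and let Λ be a compact invariant set that is Lyapunov stable for the time-reversed flow (t,x) ↦ Φ_{−t}(x). If a point x ∈ M satisfies ω(x) ∩ Λ ≠ ∅, then x ∈ Λ, and consequently ω(x) ⊆ Λ. -/
open Set Filter Topology

theorem stmt_2 {M : Type*} [MetricSpace M] [CompactSpace M]
    (Φ : ℝ → M → M)
    (hΦcont : Continuous fun p : ℝ × M => Φ p.1 p.2)
    (hΦ0 : ∀ x, Φ 0 x = x)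
    (hΦadd : ∀ t s : ℝ, ∀ x, Φ (t + s) x = Φ t (Φ s x))
    (Λ : Set M)
    (hK : IsCompact Λ) (hInv : ∀ t : ℝ, Φ t '' Λ = Λ)
    (hStab : LyapunovStable (fun t => Φ (-t)) Λ)
    (x : M) (hx : (omegaSet Φ x ∩ Λ).Nonempty) :
    x ∈ Λ ∧ omegaSet Φ x ⊆ Λ := by
  have hmem : x ∈ Λ := by
    by_contra hxΛ
    obtain ⟨y, ⟨t, ht, hty⟩, hy⟩ := hx
    have hU : ({x}ᶜ : Set M) ∈ 𝓝ˢ Λ := by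
      apply isOpen_compl_singleton.mem_nhdsSet.2
      intro z hz hzx
      rw [mem_singleton_iff] at hzx
      exact hxΛ (hzx ▸ hz)
    obtain ⟨V, hV, -, h⟩ := hStab _ hU
    have hVy : V ∈ 𝓝 y := mem_nhdsSet_iff_forall.1 hV y hy
    obtain ⟨k, hk, hk0⟩ := ((hty.eventually_mem hVy).and (ht.eventually_ge_atTop 0)).exists
    apply h (t k) hk0 _ hk
    simp only [mem_singleton_iff]
    rw [← hΦadd, neg_add_cancel, hΦ0]
  refine ⟨hmem, ?_⟩
  rintro y ⟨t, -, hty⟩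
  refine hK.isClosed.mem_of_tendsto hty (Eventually.of_forall fun k => ?_)
  rw [← hInv (t k)]
  exact mem_image_of_mem _ hmem
end

section
/- Let Φ be a continuous flow on a compact metric space M and let Λ₁, …, Λ_r be finitely many pairwise disjoint neutral compact subsets of M (each Λ_i = Λ_i⁺ ∩ Λ_i⁻ where Λ_i⁺ is a compact invariant Lyapunov stable set for Φ and Λ_i⁻ is a compact invariant Lyapunov stable set for the time-reversed flow). Set Λ = Λ₁ ∪ … ∪ Λ_r. Then the weak basin of Λ is the union of the basins of the pieces: {x ∈ M : ω(x) ∩ Λ ≠ ∅} = ⋃_{i=1}^r {x ∈ M : ω(x) ⊆ Λ_i}. -/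
open Set Filter Topology

theorem stmt_3 {M : Type*} [MetricSpace M] [CompactSpace M]
    (Φ : ℝ → M → M)
    (hΦcont : Continuous fun p : ℝ × M => Φ p.1 p.2)
    (hΦ0 : ∀ x, Φ 0 x = x)
    (hΦadd : ∀ t s : ℝ, ∀ x, Φ (t + s) x = Φ t (Φ s x))
    (r : ℕ) (Λ Λp Λm : Fin r → Set M)
    (hΛ : ∀ i, Λ i = Λp i ∩ Λm i)
    (hpK : ∀ i, IsCompact (Λp i)) (hpInv : ∀ i, ∀ t : ℝ, Φ t '' Λp i = Λp i)
    (hpStab : ∀ i, LyapunovStable Φ (Λp i))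
    (hmK : ∀ i, IsCompact (Λm i)) (hmInv : ∀ i, ∀ t : ℝ, Φ t '' Λm i = Λm i)
    (hmStab : ∀ i, LyapunovStable (fun t => Φ (-t)) (Λm i))
    (hdisj : ∀ i j, i ≠ j → Disjoint (Λ i) (Λ j)) :
    {x | (omegaSet Φ x ∩ ⋃ i, Λ i).Nonempty} = ⋃ i, {x | omegaSet Φ x ⊆ Λ i} := by
  ext x
  simp only [mem_setOf_eq, mem_iUnion]
  constructor
  · rintro ⟨p, ⟨t, ht, hp⟩, hpU⟩
    obtain ⟨i, hi⟩ := mem_iUnion.1 hpU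
    rw [hΛ i] at hi
    refine ⟨i, ?_⟩
    rintro y ⟨s, hs, hy⟩
    rw [hΛ i]
    constructor
    · by_contra hny
      have hd : Disjoint (𝓝ˢ (Λp i)) (𝓝 y) := by
        rw [disjoint_nhdsSet_nhds, (hpK i).isClosed.closure_eq]
        exact hny
      obtain ⟨U, hU, W, hW, hUW⟩ := Filter.disjoint_iff.1 hd
      obtain ⟨V, hV, -, hVU⟩ := hpStab i U hU
      have hVp : V ∈ 𝓝 p := nhds_le_nhdsSet hi.1 hV
      obtain ⟨k, hk⟩ := (hp.eventually hVp).exists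
      obtain ⟨m, hm1, hm2⟩ := ((hy.eventually hW).and (hs.eventually_ge_atTop (t k))).exists
      refine hUW.le_bot ⟨?_, hm1⟩
      have := hVU (s m - t k) (by linarith) _ hk
      rw [← hΦadd] at this
      simpa using this
    · have hx : x ∈ Λm i := by
        by_contra hny
        have hd : Disjoint (𝓝ˢ (Λm i)) (𝓝 x) := by
          rw [disjoint_nhdsSet_nhds, (hmK i).isClosed.closure_eq]
          exact hny
        obtain ⟨U, hU, W, hW, hUW⟩ := Filter.disjoint_iff.1 hd
        obtain ⟨V, hV, -, hVU⟩ := hmStab i U hU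
        have hVp : V ∈ 𝓝 p := nhds_le_nhdsSet hi.2 hV
        obtain ⟨k, hk1, hk2⟩ := ((hp.eventually hVp).and (ht.eventually_ge_atTop 0)).exists
        refine hUW.le_bot ⟨?_, mem_of_mem_nhds hW⟩
        have := hVU (t k) hk2 _ hk1
        simp only [← hΦadd] at this
        simpa [hΦ0] using this
      refine (hmK i).isClosed.mem_of_tendsto hy (Eventually.of_forall fun k => ?_)
      rw [← hmInv i (s k)]
      exact mem_image_of_mem _ hx
  · rintro ⟨i, hi⟩
    obtain ⟨y, φ, hφ, hy⟩ := CompactSpace.tendsto_subseq (fun k : ℕ => Φ (k : ℝ) x)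
    have hyω : y ∈ omegaSet Φ x :=
      ⟨fun k => (φ k : ℝ), tendsto_natCast_atTop_atTop.comp hφ.tendsto_atTop, hy⟩
    exact ⟨y, hyω, mem_iUnion.2 ⟨i, hi hyω⟩⟩
end

section
/- Let M be a compact metric space, m a Borel probability measure on M, Φ a continuous flow on M, and J : [0,∞) × M → (0,∞) a continuous function satisfying the cocycle identity J(t+r, x) = J(r, Φ_t(x)) · J(t, x) for all t, r ≥ 0 and x ∈ M. Assume (i) ∫_M J(t, x) dm(x) ≤ 1 for every t ≥ 0, and (ii) for every η > 0 there exists s ∈ (0,1] such that |J(r, y) − 1| ≤ η for all 0 ≤ r ≤ s and all y ∈ M. Then for every δ > 0 the set Λ_δ = {x ∈ M : ∃N ∈ ℕ such that J(t,x) < (1+δ)^t for all t ≥ N} has full m-measure. -/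
open MeasureTheory Filter Set

theorem stmt_5 {M : Type*} [MetricSpace M] [CompactSpace M]
    [MeasurableSpace M] [BorelSpace M]
    (m : Measure M) [IsProbabilityMeasure m]
    (Φ : ℝ → M → M)
    (hΦcont : Continuous fun p : ℝ × M => Φ p.1 p.2)
    (hΦ0 : ∀ x, Φ 0 x = x)
    (hΦadd : ∀ t s : ℝ, ∀ x, Φ (t + s) x = Φ t (Φ s x))
    (J : ℝ → M → ℝ)
    (hJcont : ContinuousOn (fun p : ℝ × M => J p.1 p.2) (Ici 0 ×ˢ univ))
    (hJpos : ∀ t : ℝ, 0 ≤ t → ∀ x, 0 < J t x)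
    (hJcoc : ∀ t r : ℝ, 0 ≤ t → 0 ≤ r → ∀ x, J (t + r) x = J r (Φ t x) * J t x)
    (hJint : ∀ t : ℝ, 0 ≤ t → ∫ x, J t x ∂m ≤ 1)
    (hJsmall : ∀ η : ℝ, 0 < η → ∃ s : ℝ, 0 < s ∧ s ≤ 1 ∧
      ∀ r : ℝ, 0 ≤ r → r ≤ s → ∀ y, |J r y - 1| ≤ η)
    (δ : ℝ) (hδ : 0 < δ) :
    m {x | ∃ N : ℕ, ∀ t : ℝ, (N : ℝ) ≤ t → J t x < (1 + δ) ^ t} = 1 := by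
  have hs1 : IsCompact (Icc (0:ℝ) 1 ×ˢ (univ : Set M)) := isCompact_Icc.prod isCompact_univ
  obtain ⟨C, hC⟩ := hs1.exists_bound_of_continuousOn
    (hJcont.mono (Set.prod_mono (fun t ht => ht.1) (le_refl _)))
  obtain ⟨K, hK0, hK⟩ : ∃ K : ℝ, 0 < K ∧ ∀ r : ℝ, 0 ≤ r → r ≤ 1 → ∀ y, J r y ≤ K := by
    refine ⟨max C 1, lt_max_of_lt_right one_pos, fun r h0 h1 y => ?_⟩
    exact (le_abs_self _).trans ((hC (r, y) ⟨⟨h0, h1⟩, mem_univ _⟩).trans (le_max_left _ _))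
  have hcont : ∀ t : ℝ, 0 ≤ t → Continuous (J t) := by
    intro t ht
    have : Continuous ((fun p : ℝ × M => J p.1 p.2) ∘ fun x : M => (t, x)) :=
      hJcont.comp_continuous (by fun_prop) (fun x => ⟨ht, mem_univ _⟩)
    exact this
  have hint : ∀ t : ℝ, 0 ≤ t → Integrable (J t) m := fun t ht =>
    (hcont t ht).integrable_of_hasCompactSupport
      (HasCompactSupport.of_compactSpace _)
  have hd1 : (0:ℝ) < 1 + δ := by linarith
  have hbound : ∀ n : ℕ, m {x | (1 + δ) ^ n / K ≤ J n x} ≤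
      ENNReal.ofReal (K * ((1 + δ)⁻¹) ^ n) := by
    intro n
    have hn : (0:ℝ) ≤ n := n.cast_nonneg
    have h := mul_meas_ge_le_integral_of_nonneg
      (Eventually.of_forall fun x => (hJpos n hn x).le) (hint n hn) ((1 + δ) ^ n / K)
    have h2 := h.trans (hJint n hn)
    have hp : 0 < (1 + δ) ^ n / K := by positivity
    rw [← ENNReal.ofReal_toReal (measure_ne_top m _)]
    apply ENNReal.ofReal_le_ofReal
    have h3 : (m {x | (1 + δ) ^ n / K ≤ J n x}).toReal ≤ 1 / ((1 + δ) ^ n / K) := by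
      rw [le_div_iff₀ hp, mul_comm]
      exact h2
    refine h3.trans (le_of_eq ?_)
    rw [inv_pow]
    field_simp
  have hsum : Summable fun n : ℕ => K * ((1 + δ)⁻¹) ^ n :=
    (summable_geometric_of_lt_one (by positivity) (inv_lt_one_of_one_lt₀ (by linarith))).mul_left K
  have hfin : ∑' n : ℕ, m {x | (1 + δ) ^ n / K ≤ J n x} ≠ ⊤ :=
    ne_top_of_le_ne_top hsum.tsum_ofReal_ne_top (ENNReal.tsum_le_tsum hbound)
  have hae := ae_eventually_notMem hfin
  have hall : ∀ᵐ x ∂m, x ∈ {x | ∃ N : ℕ, ∀ t : ℝ, (N : ℝ) ≤ t → J t x < (1 + δ) ^ t} := by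
    filter_upwards [hae] with x hx
    obtain ⟨N, hN⟩ := eventually_atTop.1 hx
    refine ⟨N, fun t ht => ?_⟩
    have ht0 : (0:ℝ) ≤ t := N.cast_nonneg.trans ht
    have h1 := Nat.floor_le ht0
    have h2 := Nat.lt_floor_add_one t
    have h3 := hN ⌊t⌋₊ (Nat.le_floor ht)
    simp only [mem_ofPred_eq, not_le] at h3
    have h4 := hJcoc (⌊t⌋₊ : ℝ) (t - ⌊t⌋₊) (Nat.cast_nonneg _) (by linarith) x
    rw [add_sub_cancel] at h4
    have h5 := hK (t - ⌊t⌋₊) (by linarith) (by linarith) (Φ ⌊t⌋₊ x)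
    have h6 := hJpos (⌊t⌋₊ : ℝ) (Nat.cast_nonneg _) x
    calc J t x ≤ K * J ⌊t⌋₊ x := by rw [h4]; gcongr
      _ < K * ((1 + δ) ^ ⌊t⌋₊ / K) := by gcongr
      _ = (1 + δ) ^ (⌊t⌋₊ : ℝ) := by rw [Real.rpow_natCast]; field_simp
      _ ≤ (1 + δ) ^ t := Real.rpow_le_rpow_of_exponent_le (by linarith) h1
  exact (measure_congr (eventuallyEq_univ.2 hall)).trans measure_univ
end

section
/- Let Φ be a flow on a set M and J : [0,∞) × M → (0,∞) a multiplicative cocycle over Φ, i.e. J(t+r, x) = J(r, Φ_t(x)) · J(t, x) for all t, r ≥ 0 and x ∈ M. Let η > 0, 0 < s ≤ 1, ρ > 0 and δ > 0 satisfy: |J(r, y) − 1| ≤ η for all 0 ≤ r ≤ s and all y ∈ M, and (1+η)(1+ρ)^t < (1+δ)^t for all t ≥ 1. If x ∈ M and N ≥ 1 is an integer such that J(ns, x) < (1+ρ)^{ns} for every integer n ≥ N, then J(t, x) < (1+δ)^t for every real t ≥ N. -/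
theorem stmt_6 {M : Type*} (Φ : ℝ → M → M)
    (hΦ0 : ∀ x, Φ 0 x = x)
    (hΦadd : ∀ t s : ℝ, ∀ x, Φ (t + s) x = Φ t (Φ s x))
    (J : ℝ → M → ℝ)
    (hJpos : ∀ t : ℝ, 0 ≤ t → ∀ y, 0 < J t y)
    (hJcoc : ∀ t r : ℝ, 0 ≤ t → 0 ≤ r → ∀ y, J (t + r) y = J r (Φ t y) * J t y)
    (η s ρ δ : ℝ) (hη : 0 < η) (hs0 : 0 < s) (hs1 : s ≤ 1) (hρ : 0 < ρ) (hδ : 0 < δ)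
    (hsmall : ∀ r : ℝ, 0 ≤ r → r ≤ s → ∀ y, |J r y - 1| ≤ η)
    (hcomp : ∀ t : ℝ, 1 ≤ t → (1 + η) * (1 + ρ) ^ t < (1 + δ) ^ t)
    (x : M) (N : ℕ) (hN : 1 ≤ N)
    (hx : ∀ n : ℕ, N ≤ n → J (n * s) x < (1 + ρ) ^ ((n : ℝ) * s)) :
    ∀ t : ℝ, (N : ℝ) ≤ t → J t x < (1 + δ) ^ t := by
  intro t ht
  have hN' : (1 : ℝ) ≤ N := by exact_mod_cast hN
  have ht1 : 1 ≤ t := hN'.trans ht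
  have ht0 : 0 ≤ t / s := by positivity
  have hle : t ≤ t / s := by
    rw [le_div_iff₀ hs0]; nlinarith
  have hn : N ≤ ⌊t / s⌋₊ := Nat.le_floor (ht.trans hle)
  have h1 := Nat.floor_le ht0
  have h2 := Nat.lt_floor_add_one (t / s)
  generalize ⌊t / s⌋₊ = n at *
  rw [le_div_iff₀ hs0] at h1
  rw [div_lt_iff₀ hs0] at h2
  have hns : 0 ≤ (n : ℝ) * s := by positivity
  have hr0 : 0 ≤ t - n * s := by linarith
  have hrs : t - n * s ≤ s := by linarith
  have hc := hJcoc (n * s) (t - n * s) hns hr0 x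
  rw [add_sub_cancel] at hc
  have hb := (abs_le.mp (hsmall _ hr0 hrs (Φ (n * s) x))).2
  have hp := hJpos _ hns x
  have hxn := hx n hn
  have hm : (1 + ρ) ^ ((n : ℝ) * s) ≤ (1 + ρ) ^ t :=
    Real.rpow_le_rpow_of_exponent_le (by linarith) h1
  calc J t x = J (t - n * s) (Φ (n * s) x) * J (n * s) x := hc
    _ ≤ (1 + η) * J (n * s) x := mul_le_mul_of_nonneg_right (by linarith) hp.le
    _ ≤ (1 + η) * (1 + ρ) ^ t := mul_le_mul_of_nonneg_left (by linarith) (by linarith)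
    _ < (1 + δ) ^ t := hcomp t ht1
end

section
/- Let M be a compact metric space, Φ a continuous flow on M, m a Borel probability measure on M, and φ : M → ℝ a continuous function such that ∫_M exp(∫_0^t φ(Φ_s(x)) ds) dm(x) ≤ 1 for every t ≥ 0. Then for m-almost every x ∈ M the following holds: for every Borel probability measure μ on M and every sequence t_k → ∞ such that the empirical measures μ_{x,t_k} converge weakly to μ, one has ∫_M φ dμ ≤ 0. -/
open MeasureTheory Filter Topology

/-- The empirical measure `μ_{x,t} = (1/t) ∫_0^t δ_{Φ_s x} ds`: the pushforward under
`s ↦ Φ s x` of the normalized Lebesgue measure on `(0, t]`. -/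
noncomputable def empMeasure {M : Type*} [MeasurableSpace M]
    (Φ : ℝ → M → M) (x : M) (t : ℝ) : Measure M :=
  ((ENNReal.ofReal t)⁻¹ • volume.restrict (Set.Ioc 0 t)).map (fun s => Φ s x)

theorem aux_emp {M : Type*} [MetricSpace M]
    [MeasurableSpace M] [BorelSpace M]
    (Φ : ℝ → M → M) (x : M) (hc : Continuous fun s => Φ s x)
    (φ : M → ℝ) (hφ : Continuous φ) (t : ℝ) (ht : 0 < t) :
    ∫ y, φ y ∂(empMeasure Φ x t) = t⁻¹ * ∫ s in (0:ℝ)..t, φ (Φ s x) := by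
  unfold empMeasure
  rw [integral_map hc.measurable.aemeasurable]
  · rw [integral_smul_measure, intervalIntegral.integral_of_le ht.le]
    simp [ENNReal.toReal_inv, ENNReal.toReal_ofReal ht.le]
  · exact hφ.measurable.aestronglyMeasurable

theorem stmt_7 {M : Type*} [MetricSpace M] [CompactSpace M]
    [MeasurableSpace M] [BorelSpace M]
    (m : Measure M) [IsProbabilityMeasure m]
    (Φ : ℝ → M → M)
    (hΦcont : Continuous fun p : ℝ × M => Φ p.1 p.2)
    (hΦ0 : ∀ x, Φ 0 x = x)
    (hΦadd : ∀ t s : ℝ, ∀ x, Φ (t + s) x = Φ t (Φ s x))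
    (φ : M → ℝ) (hφ : Continuous φ)
    (hint : ∀ t : ℝ, 0 ≤ t → ∫ x, Real.exp (∫ s in (0:ℝ)..t, φ (Φ s x)) ∂m ≤ 1) :
    ∀ᵐ x ∂m, ∀ μ : Measure M, IsProbabilityMeasure μ →
      ∀ tk : ℕ → ℝ, Tendsto tk atTop atTop →
      (∀ f : M → ℝ, Continuous f →
        Tendsto (fun k => ∫ y, f y ∂(empMeasure Φ x (tk k))) atTop (𝓝 (∫ y, f y ∂μ))) →
      ∫ y, φ y ∂μ ≤ 0 := by
  have hcx : ∀ x, Continuous fun s => Φ s x := fun x =>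
    hΦcont.comp (by fun_prop : Continuous fun s : ℝ => (s, x))
  have hSc : ∀ t : ℝ, Continuous fun x => ∫ s in (0:ℝ)..t, φ (Φ s x) := fun t => by
    apply intervalIntegral.continuous_parametric_intervalIntegral_of_continuous'
    exact hφ.comp (hΦcont.comp (by fun_prop : Continuous fun p : M × ℝ => (p.2, p.1)))
  have hec : ∀ t : ℝ, Continuous fun x => Real.exp (∫ s in (0:ℝ)..t, φ (Φ s x)) :=
    fun t => Real.continuous_exp.comp (hSc t)
  obtain ⟨K, hK⟩ : ∃ K, ∀ y, φ y ≤ K := by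
    obtain ⟨K, hK⟩ := (isCompact_range hφ).bddAbove
    exact ⟨K, fun y => hK ⟨y, rfl⟩⟩
  have hlin : ∀ t : ℝ, 0 ≤ t →
      ∫⁻ x, ENNReal.ofReal (Real.exp (∫ s in (0:ℝ)..t, φ (Φ s x))) ∂m ≤ 1 := by
    intro t ht
    rw [← ofReal_integral_eq_lintegral_ofReal]
    · exact ENNReal.ofReal_le_one.2 (hint t ht)
    · exact (hec t).integrable_of_hasCompactSupport (HasCompactSupport.of_compactSpace _)
    · exact Eventually.of_forall fun x => (Real.exp_pos _).le
  have hsum : ∑' n : ℕ, ENNReal.ofReal (1 / ((n : ℝ) + 1) ^ 2) ≠ ⊤ := by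
    have h : Summable fun n : ℕ => 1 / ((n : ℝ) + 1) ^ 2 := by
      have := (summable_nat_add_iff 1).2 (Real.summable_one_div_nat_pow.2 (one_lt_two))
      simpa using this
    exact h.tsum_ofReal_ne_top
  have hae : ∀ᵐ x ∂m, ∑' n : ℕ, ENNReal.ofReal (1 / ((n : ℝ) + 1) ^ 2) *
      ENNReal.ofReal (Real.exp (∫ s in (0:ℝ)..n, φ (Φ s x))) < ⊤ := by
    have hme : ∀ n : ℕ, Measurable fun x => ENNReal.ofReal (1 / ((n : ℝ) + 1) ^ 2) *
      ENNReal.ofReal (Real.exp (∫ s in (0:ℝ)..n, φ (Φ s x))) := fun n =>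
        (hec n).measurable.ennreal_ofReal.const_mul _
    apply ae_lt_top (Measurable.ennreal_tsum hme)
    rw [lintegral_tsum fun n => (hme n).aemeasurable]
    refine ne_top_of_le_ne_top hsum (ENNReal.tsum_le_tsum fun n => ?_)
    rw [lintegral_const_mul _ (hec n).measurable.ennreal_ofReal]
    exact mul_le_of_le_one_right' (hlin n n.cast_nonneg)
  filter_upwards [hae] with x hx μ hμ tk htk hconv
  set S : ℝ → ℝ := fun t => ∫ s in (0:ℝ)..t, φ (Φ s x) with hS
  obtain ⟨C, hC⟩ : ∃ C : ℝ, ∀ n : ℕ, S n ≤ C + 2 * Real.log (n + 1) := by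
    set T := ∑' n : ℕ, ENNReal.ofReal (1 / ((n : ℝ) + 1) ^ 2) *
      ENNReal.ofReal (Real.exp (∫ s in (0:ℝ)..n, φ (Φ s x)))
    refine ⟨Real.log T.toReal, fun n => ?_⟩
    have h1 : ENNReal.ofReal (1 / ((n : ℝ) + 1) ^ 2) * ENNReal.ofReal (Real.exp (S n)) ≤ T :=
      ENNReal.le_tsum (f := fun n : ℕ => ENNReal.ofReal (1 / ((n : ℝ) + 1) ^ 2) *
        ENNReal.ofReal (Real.exp (∫ s in (0:ℝ)..n, φ (Φ s x)))) n
    rw [← ENNReal.ofReal_mul (by positivity), ENNReal.ofReal_le_iff_le_toReal hx.ne] at h1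
    have h2 := Real.log_le_log (by positivity) h1
    rw [Real.log_mul (by positivity) (by positivity), Real.log_exp, one_div, Real.log_inv,
      Real.log_pow] at h2
    push_cast at h2
    linarith
  have hii : ∀ a b : ℝ, IntervalIntegrable (fun s => φ (Φ s x)) volume a b :=
    fun a b => (hφ.comp (hcx x)).intervalIntegrable a b
  have hbound : ∀ t : ℝ, 1 ≤ t → S t ≤ C + 2 * (Real.log 2 + Real.log t) + |K| := by
    intro t ht
    have hf := Nat.floor_le (by linarith : 0 ≤ t)
    have hf2 := Nat.lt_floor_add_one t
    have e : S t = S ⌊t⌋₊ + ∫ s in (⌊t⌋₊ : ℝ)..t, φ (Φ s x) :=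
      (intervalIntegral.integral_add_adjacent_intervals (hii _ _) (hii _ _)).symm
    have h1 : ∫ s in (⌊t⌋₊ : ℝ)..t, φ (Φ s x) ≤ ∫ s in (⌊t⌋₊ : ℝ)..t, |K| :=
      intervalIntegral.integral_mono hf (hii _ _) (by simp) fun s => (hK _).trans (le_abs_self K)
    rw [intervalIntegral.integral_const, smul_eq_mul] at h1
    have h2 : Real.log (⌊t⌋₊ + 1) ≤ Real.log 2 + Real.log t := by
      rw [← Real.log_mul (by norm_num) (by linarith)]
      exact Real.log_le_log (by positivity) (by linarith)
    have := hC ⌊t⌋₊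
    nlinarith [abs_nonneg K]
  have hlim : Tendsto (fun t : ℝ => t⁻¹ * (C + 2 * (Real.log 2 + Real.log t) + |K|))
      atTop (𝓝 0) := by
    have h1 : Tendsto (fun t : ℝ => Real.log t / t) atTop (𝓝 0) :=
      Real.isLittleO_log_id_atTop.tendsto_div_nhds_zero
    have h2 := (tendsto_inv_atTop_zero (𝕜 := ℝ)).const_mul (C + 2 * Real.log 2 + |K|)
    have h3 := h2.add (h1.const_mul 2)
    simp only [mul_zero, add_zero] at h3
    refine h3.congr fun t => ?_
    rw [div_eq_mul_inv]; ring
  refine le_of_tendsto_of_tendsto (hconv φ hφ) (hlim.comp htk) ?_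
  filter_upwards [htk.eventually_ge_atTop 1] with k hk
  rw [aux_emp Φ x (hcx x) φ hφ _ (by linarith)]
  exact mul_le_mul_of_nonneg_left (hbound _ hk) (by positivity)
end

section
/- Let M be a compact metric space, Φ a continuous flow on M, and U ⊆ M a compact set. Define Λ = ⋂_{t∈ℝ} Φ_t(U) and assume Λ is contained in the interior of U. Then for every x ∈ M: ω(x) ⊆ Λ if and only if there exists T ≥ 0 such that Φ_t(x) ∈ U for all t ≥ T. Equivalently, the basin W^s(Λ) = {x : ω(x) ⊆ Λ} equals ⋃_{T≥0} Φ_{−T}(Λ^∞), where Λ^∞ = ⋂_{t≥0} Φ_{−t}(U) is the set of points whose entire forward orbit lies in U. -/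
open Set Filter Topology

theorem stmt_13 {M : Type*} [MetricSpace M] [CompactSpace M]
    (Φ : ℝ → M → M)
    (hΦcont : Continuous fun p : ℝ × M => Φ p.1 p.2)
    (hΦ0 : ∀ x, Φ 0 x = x)
    (hΦadd : ∀ t s : ℝ, ∀ x, Φ (t + s) x = Φ t (Φ s x))
    (U : Set M) (hU : IsCompact U)
    (Λ : Set M) (hΛ : Λ = ⋂ t : ℝ, Φ t '' U)
    (hΛint : Λ ⊆ interior U) :
    (∀ x : M, omegaSet Φ x ⊆ Λ ↔ ∃ T : ℝ, 0 ≤ T ∧ ∀ t : ℝ, T ≤ t → Φ t x ∈ U) ∧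
    {x | omegaSet Φ x ⊆ Λ} =
      ⋃ T ∈ Ici (0 : ℝ), Φ (-T) '' {y | ∀ t : ℝ, 0 ≤ t → Φ t y ∈ U} := by
  have key : ∀ x : M, omegaSet Φ x ⊆ Λ ↔ ∃ T : ℝ, 0 ≤ T ∧ ∀ t : ℝ, T ≤ t → Φ t x ∈ U := by
    intro x
    constructor
    · intro h
      by_contra hcon
      push Not at hcon
      have h1 : ∀ n : ℕ, ∃ t : ℝ, (n : ℝ) ≤ t ∧ Φ t x ∉ U := fun n =>
        hcon n (Nat.cast_nonneg n)
      choose t ht htU using h1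
      have htt : Tendsto t atTop atTop :=
        tendsto_atTop_mono ht tendsto_natCast_atTop_atTop
      obtain ⟨y, φ, hφ, hy⟩ := CompactSpace.tendsto_subseq (fun k => Φ (t k) x)
      have hyΛ : y ∈ Λ := h ⟨t ∘ φ, htt.comp hφ.tendsto_atTop, hy⟩
      have hn : interior U ∈ 𝓝 y := isOpen_interior.mem_nhds (hΛint hyΛ)
      obtain ⟨k, hk⟩ := (hy.eventually hn).exists
      exact htU (φ k) (interior_subset hk)
    · rintro ⟨T, -, hTU⟩ y ⟨t, ht, hy⟩
      rw [hΛ, mem_iInter]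
      intro s
      refine ⟨Φ (-s) y, ?_, ?_⟩
      · have hc : Continuous (Φ (-s)) := hΦcont.comp (Continuous.prodMk_right (-s))
        refine hU.isClosed.mem_of_tendsto ((hc.tendsto y).comp hy) ?_
        filter_upwards [ht.eventually_ge_atTop (T + s)] with k hk
        simp only [Function.comp]
        rw [← hΦadd]
        exact hTU _ (by linarith)
      · rw [← hΦadd, add_neg_cancel, hΦ0]
  refine ⟨key, ?_⟩
  ext x
  rw [mem_setOf_eq, key x]
  simp only [mem_iUnion, mem_Ici, mem_image, mem_setOf_eq, exists_prop]
  constructor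
  · rintro ⟨T, hT, h⟩
    refine ⟨T, hT, Φ T x, fun t ht => ?_, ?_⟩
    · rw [← hΦadd]
      exact h _ (by linarith)
    · rw [← hΦadd, neg_add_cancel, hΦ0]
  · rintro ⟨T, hT, y, hy, rfl⟩
    refine ⟨T, hT, fun t ht => ?_⟩
    rw [← hΦadd]
    exact hy _ (by linarith)
end
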